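/- Let α be an admissible exponent of A. The operator G_α is invertible on c00(α) (bijective with bounded inverse) if and only if there exists an admissible exponent β < 0 of A such that c00(α) = c00(β) (equality as sets of sequences). -/

import Mathlib

open Filter Topology

variable {E : Type*} [NormedAddCommGroup E] [NormedSpace ℝ E] [CompleteSpace E]

/-- `evol A n m` is the evolution operator `A(m,n) = A_{m-1} ∘ ⋯ ∘ A_n`
(the identity if `m ≤ n`). -/
def evol (A : ℕ → E →L[ℝ] E) (n : ℕ) : ℕ → E →L[ℝ] E
  | 0 => 1
  | m + 1 => if n ≤ m then A m * evol A n m else 1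

/-- `α` is an admissible exponent for `A`: there is a positive sequence `M` with
`‖A(m,n)‖ ≤ M n * e^{α (m - n)}` for all `m ≥ n`. -/
def IsAdmissible (A : ℕ → E →L[ℝ] E) (α : ℝ) : Prop :=
  ∃ M : ℕ → ℝ, (∀ n, 0 < M n) ∧
    ∀ m n : ℕ, n ≤ m → ‖evol A n m‖ ≤ M n * Real.exp (α * ((m : ℝ) - (n : ℝ)))

/-- The norm `‖x‖_{n,α} = sup_{m ≥ n} e^{-α(m-n)} ‖A(m,n) x‖`. -/
noncomputable def nnorm (A : ℕ → E →L[ℝ] E) (α : ℝ) (n : ℕ) (x : E) : ℝ :=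
  ⨆ m : Set.Ici n, Real.exp (-α * (((m : ℕ) : ℝ) - (n : ℝ))) * ‖evol A n (m : ℕ) x‖

/-- Membership in `c00(α)`: `u 0 = 0` and `‖u n‖_{n,α} → 0`. -/
def MemC00 (A : ℕ → E →L[ℝ] E) (α : ℝ) (u : ℕ → E) : Prop :=
  u 0 = 0 ∧ Tendsto (fun n => nnorm A α n (u n)) atTop (𝓝 0)

/-- The norm `‖u‖_α = sup_n ‖u n‖_{n,α}` on `c00(α)`. -/
noncomputable def cnorm (A : ℕ → E →L[ℝ] E) (α : ℝ) (u : ℕ → E) : ℝ :=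
  ⨆ n, nnorm A α n (u n)

/-- The evolution map `T`: `(Tu)_0 = 0`, `(Tu)_{n+1} = A_n u_n`. -/
def Tmap (A : ℕ → E →L[ℝ] E) (u : ℕ → E) : ℕ → E
  | 0 => 0
  | m + 1 => A m (u m)

/-- `G = T - Id`. -/
def Gmap (A : ℕ → E →L[ℝ] E) (u : ℕ → E) : ℕ → E :=
  fun n => Tmap A u n - u n

/-- `G_α` is invertible on `c00(α)`: it maps `c00(α)` into itself, is bijective
on `c00(α)`, and has a bounded inverse. -/
def GInvertible (A : ℕ → E →L[ℝ] E) (α : ℝ) : Prop :=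
  (∀ u, MemC00 A α u → MemC00 A α (Gmap A u)) ∧
  (∀ v, MemC00 A α v → ∃ u, MemC00 A α u ∧ Gmap A u = v) ∧
  (∀ u : ℕ → E, MemC00 A α u → Gmap A u = 0 → u = 0) ∧
  ∃ c > 0, ∀ u, MemC00 A α u → cnorm A α u ≤ c * cnorm A α (Gmap A u)

section

omit [CompleteSpace E]

variable {A : ℕ → E →L[ℝ] E} {α β : ℝ}

lemma evol_self (A : ℕ → E →L[ℝ] E) (n : ℕ) : evol A n n = 1 := by
  cases n <;> simp [evol]

lemma evol_succ (A : ℕ → E →L[ℝ] E) {n m : ℕ} (h : n ≤ m) :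
    evol A n (m + 1) = A m * evol A n m := by
  simp [evol, h]

lemma evol_eq_mul (A : ℕ → E →L[ℝ] E) {n m : ℕ} (h : n + 1 ≤ m) :
    evol A n m = evol A (n + 1) m * A n := by
  induction m, h using Nat.le_induction with
  | base => rw [evol_succ A le_rfl, evol_self, evol_self, mul_one, one_mul]
  | succ m hm ih => rw [evol_succ A (by omega), evol_succ A hm, ih, mul_assoc]

lemma nnorm_nonneg (A : ℕ → E →L[ℝ] E) (α : ℝ) (n : ℕ) (x : E) : 0 ≤ nnorm A α n x :=
  Real.iSup_nonneg fun _ => by positivity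

lemma nnorm_le {n : ℕ} {x : E} {B : ℝ}
    (h : ∀ m, n ≤ m → Real.exp (-α * ((m : ℝ) - n)) * ‖evol A n m x‖ ≤ B) :
    nnorm A α n x ≤ B :=
  ciSup_le fun m => h m m.2

lemma nnorm_zero (A : ℕ → E →L[ℝ] E) (α : ℝ) (n : ℕ) : nnorm A α n 0 = 0 := by
  simp [nnorm]

lemma nnorm_smul (A : ℕ → E →L[ℝ] E) (α : ℝ) (n : ℕ) (t : ℝ) (x : E) :
    nnorm A α n (t • x) = |t| * nnorm A α n x := by
  simp only [nnorm, map_smul, norm_smul, Real.norm_eq_abs]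
  rw [Real.mul_iSup_of_nonneg (abs_nonneg t)]
  congr 1
  ext m
  ring

lemma nnorm_neg (A : ℕ → E →L[ℝ] E) (α : ℝ) (n : ℕ) (x : E) :
    nnorm A α n (-x) = nnorm A α n x := by
  simp [nnorm]

lemma IsAdmissible.exists_weighted_le (hα : IsAdmissible A α) :
    ∃ M : ℕ → ℝ, (∀ n, 0 < M n) ∧ ∀ (n m : ℕ) (x : E), n ≤ m →
      Real.exp (-α * ((m : ℝ) - n)) * ‖evol A n m x‖ ≤ M n * ‖x‖ := by
  obtain ⟨M, hM, h⟩ := hα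
  refine ⟨M, hM, fun n m x hnm => ?_⟩
  calc Real.exp (-α * ((m : ℝ) - n)) * ‖evol A n m x‖
      ≤ Real.exp (-α * ((m : ℝ) - n)) * (M n * Real.exp (α * ((m : ℝ) - n)) * ‖x‖) := by
        gcongr
        exact (evol A n m).le_of_opNorm_le (h m n hnm) x
    _ = (Real.exp (-α * ((m : ℝ) - n)) * Real.exp (α * ((m : ℝ) - n))) * (M n * ‖x‖) := by ring
    _ = M n * ‖x‖ := by rw [← Real.exp_add]; simp

lemma IsAdmissible.weighted_le_nnorm (hα : IsAdmissible A α) {n m : ℕ} (h : n ≤ m) (x : E) :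
    Real.exp (-α * ((m : ℝ) - n)) * ‖evol A n m x‖ ≤ nnorm A α n x := by
  obtain ⟨M, -, hM⟩ := hα.exists_weighted_le
  refine le_ciSup (f := fun m : Set.Ici n =>
    Real.exp (-α * (((m : ℕ) : ℝ) - (n : ℝ))) * ‖evol A n (m : ℕ) x‖) ⟨M n * ‖x‖, ?_⟩ ⟨m, h⟩
  rintro _ ⟨k, rfl⟩
  exact hM n k x k.2

lemma IsAdmissible.exists_nnorm_le (hα : IsAdmissible A α) :
    ∃ M : ℕ → ℝ, (∀ n, 0 < M n) ∧ ∀ n x, nnorm A α n x ≤ M n * ‖x‖ := by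
  obtain ⟨M, hM, h⟩ := hα.exists_weighted_le
  exact ⟨M, hM, fun n x => nnorm_le fun m hm => h n m x hm⟩

lemma IsAdmissible.norm_le_nnorm (hα : IsAdmissible A α) (n : ℕ) (x : E) :
    ‖x‖ ≤ nnorm A α n x := by
  simpa [evol_self] using hα.weighted_le_nnorm le_rfl x (n := n)

lemma IsAdmissible.nnorm_sub_le (hα : IsAdmissible A α) (n : ℕ) (x y : E) :
    nnorm A α n (x - y) ≤ nnorm A α n x + nnorm A α n y := by
  refine nnorm_le fun m hm => ?_
  calc Real.exp (-α * ((m : ℝ) - n)) * ‖evol A n m (x - y)‖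
      ≤ Real.exp (-α * ((m : ℝ) - n)) * (‖evol A n m x‖ + ‖evol A n m y‖) := by
        rw [map_sub]
        gcongr
        exact norm_sub_le _ _
    _ ≤ nnorm A α n x + nnorm A α n y := by
        rw [mul_add]
        exact add_le_add (hα.weighted_le_nnorm hm x) (hα.weighted_le_nnorm hm y)

lemma IsAdmissible.nnorm_succ_le (hα : IsAdmissible A α) (n : ℕ) (x : E) :
    nnorm A α (n + 1) (A n x) ≤ Real.exp α * nnorm A α n x := by
  refine nnorm_le fun m hm => ?_
  calc Real.exp (-α * ((m : ℝ) - (n + 1 : ℕ))) * ‖evol A (n + 1) m (A n x)‖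
      = Real.exp α * (Real.exp (-α * ((m : ℝ) - n)) * ‖evol A n m x‖) := by
        rw [evol_eq_mul A hm, ← mul_assoc, ← Real.exp_add]
        congr 2
        push_cast
        ring
    _ ≤ Real.exp α * nnorm A α n x := by
        gcongr
        exact hα.weighted_le_nnorm (by omega) x

lemma IsAdmissible.nnorm_le_nnorm (hβ : IsAdmissible A β) (h : β ≤ α) (n : ℕ) (x : E) :
    nnorm A α n x ≤ nnorm A β n x := by
  refine nnorm_le fun m hm => le_trans ?_ (hβ.weighted_le_nnorm hm x)
  have : (0 : ℝ) ≤ (m : ℝ) - n := sub_nonneg.2 (by exact_mod_cast hm)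
  gcongr

lemma MemC00.of_nnorm_le {K : ℝ} {u : ℕ → E} (hu : MemC00 A α u)
    (h : ∀ᶠ n in atTop, ∀ x, nnorm A β n x ≤ K * nnorm A α n x) : MemC00 A β u := by
  refine ⟨hu.1, squeeze_zero' (.of_forall fun n => nnorm_nonneg _ _ _ _)
    (h.mono fun n hn => hn (u n)) ?_⟩
  simpa using hu.2.const_mul K

lemma MemC00.nnorm_le_cnorm {u : ℕ → E} (hu : MemC00 A α u) (n : ℕ) :
    nnorm A α n (u n) ≤ cnorm A α u :=
  le_ciSup (f := fun n => nnorm A α n (u n)) hu.2.bddAbove_range n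

lemma Gmap_succ (A : ℕ → E →L[ℝ] E) (u : ℕ → E) (n : ℕ) :
    Gmap A u (n + 1) = A n (u n) - u (n + 1) := rfl

lemma Gmap_zero (A : ℕ → E →L[ℝ] E) (u : ℕ → E) : Gmap A u 0 = -u 0 := by
  simp [Gmap, Tmap]

lemma Gmap_injective (A : ℕ → E →L[ℝ] E) : Function.Injective (Gmap A) := by
  intro u v h
  ext n
  induction n with
  | zero => simpa [Gmap_zero] using congrFun h 0
  | succ n ih => simpa [Gmap_succ, ih] using congrFun h (n + 1)

lemma exists_Gmap_eq (A : ℕ → E →L[ℝ] E) (v : ℕ → E) : ∃ u, Gmap A u = v := by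
  refine ⟨fun n => Nat.rec (-v 0) (fun n y => A n y - v (n + 1)) n, ?_⟩
  ext n
  cases n with
  | zero => simp [Gmap_zero]
  | succ n => simp [Gmap_succ]

lemma IsAdmissible.memC00_Gmap (hα : IsAdmissible A α) {u : ℕ → E} (hu : MemC00 A α u) :
    MemC00 A α (Gmap A u) := by
  refine ⟨by rw [Gmap_zero, hu.1, neg_zero], (tendsto_add_atTop_iff_nat 1).1 ?_⟩
  refine squeeze_zero (fun n => nnorm_nonneg _ _ _ _)
    (g := fun n => Real.exp α * nnorm A α n (u n) + nnorm A α (n + 1) (u (n + 1)))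
    (fun n => ?_) ?_
  · rw [Gmap_succ]
    exact (hα.nnorm_sub_le _ _ _).trans (add_le_add_left (hα.nnorm_succ_le n _) _)
  · simpa using (hu.2.const_mul (Real.exp α)).add ((tendsto_add_atTop_iff_nat 1).2 hu.2)

/-- A sequence `a` with `a (n + 1) ≤ q * a n + b (n + 1)` and `q < 1` is controlled by `b`. -/
lemma le_of_le_mul_add {q B : ℝ} (hq0 : 0 ≤ q) (hq : q < 1) {a b : ℕ → ℝ}
    (h : ∀ n, a (n + 1) ≤ q * a n + b n) {N : ℕ} (hb : ∀ n, N ≤ n → b n ≤ B) (n : ℕ) :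
    a (N + n) ≤ q ^ n * a N + (1 - q)⁻¹ * B - q ^ n * ((1 - q)⁻¹ * B) := by
  have hB : B = (1 - q) * ((1 - q)⁻¹ * B) := by
    rw [← mul_assoc, mul_inv_cancel₀ (by linarith), one_mul]
  induction n with
  | zero => simp
  | succ n ih =>
    have h1 := h (N + n)
    have h2 := hb (N + n) (by omega)
    have h3 := mul_le_mul_of_nonneg_left ih hq0
    rw [← add_assoc, pow_succ]
    nlinarith

lemma tendsto_zero_of_le_mul_add {q : ℝ} (hq0 : 0 ≤ q) (hq : q < 1) {a b : ℕ → ℝ}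
    (ha : ∀ n, 0 ≤ a n) (h : ∀ n, a (n + 1) ≤ q * a n + b n) (hb : Tendsto b atTop (𝓝 0)) :
    Tendsto a atTop (𝓝 0) := by
  have hq' : 0 < 1 - q := by linarith
  refine (tendsto_order.2 ⟨fun l hl => .of_forall fun n => hl.trans_le (ha n), fun ε hε => ?_⟩)
  have hB : 0 < (1 - q) * (ε / 2) := by positivity
  obtain ⟨N, hN⟩ := eventually_atTop.1 ((tendsto_order.1 hb).2 _ hB)
  have key := le_of_le_mul_add hq0 hq h (N := N) (fun n hn => (hN n hn).le)
  rw [inv_mul_cancel_left₀ hq'.ne'] at key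
  have ht : Tendsto (fun n => q ^ n * a N + ε / 2 - q ^ n * (ε / 2)) atTop (𝓝 (ε / 2)) := by
    have hp := tendsto_pow_atTop_nhds_zero_of_lt_one hq0 hq
    simpa using ((hp.mul_const (a N)).add_const (ε / 2)).sub (hp.mul_const (ε / 2))
  obtain ⟨K, hK⟩ := eventually_atTop.1 ((tendsto_order.1 ht).2 ε (by linarith))
  filter_upwards [eventually_ge_atTop (N + K)] with n hn
  obtain ⟨k, rfl⟩ := Nat.exists_eq_add_of_le (show N ≤ n by omega)
  exact (key k).trans_lt (hK k (by omega))

lemma IsAdmissible.nnorm_succ_le_Gmap (hβ : IsAdmissible A β) (u : ℕ → E) (n : ℕ) :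
    nnorm A β (n + 1) (u (n + 1)) ≤
      Real.exp β * nnorm A β n (u n) + nnorm A β (n + 1) (Gmap A u (n + 1)) := by
  have : u (n + 1) = A n (u n) - Gmap A u (n + 1) := by rw [Gmap_succ]; abel
  calc nnorm A β (n + 1) (u (n + 1))
      ≤ nnorm A β (n + 1) (A n (u n)) + nnorm A β (n + 1) (Gmap A u (n + 1)) := by
        conv_lhs => rw [this]
        exact hβ.nnorm_sub_le _ _ _
    _ ≤ _ := by
        gcongr
        exact hβ.nnorm_succ_le n _

lemma IsAdmissible.memC00_of_Gmap (hβ : IsAdmissible A β) (hβ0 : β < 0) {u : ℕ → E}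
    (hu : MemC00 A β (Gmap A u)) : MemC00 A β u :=
  ⟨by simpa [Gmap_zero] using hu.1,
    tendsto_zero_of_le_mul_add (Real.exp_pos β).le (by simpa using hβ0)
      (fun n => nnorm_nonneg _ _ _ _) (hβ.nnorm_succ_le_Gmap u)
      ((tendsto_add_atTop_iff_nat 1).2 hu.2)⟩

lemma IsAdmissible.nnorm_le_of_Gmap (hβ : IsAdmissible A β) (hβ0 : β < 0) {u : ℕ → E} {B : ℝ}
    (hu : u 0 = 0) (hB : ∀ n, nnorm A β n (Gmap A u n) ≤ B) (n : ℕ) :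
    nnorm A β n (u n) ≤ (1 - Real.exp β)⁻¹ * B := by
  have h1 : 0 < 1 - Real.exp β := sub_pos.2 (by simpa using hβ0)
  have hB0 : 0 ≤ B := (nnorm_nonneg _ _ _ _).trans (hB 0)
  have key := le_of_le_mul_add (Real.exp_pos β).le (by simpa using hβ0)
    (a := fun n => nnorm A β n (u n)) (hβ.nnorm_succ_le_Gmap u) (N := 0) (fun n _ => hB (n + 1)) n
  simp only [zero_add, hu, nnorm_zero, mul_zero] at key
  exact key.trans (sub_le_self _ (by positivity))

/-- An inclusion `c00(β) ⊆ c00(α)` makes the `α`-norms uniformly bounded by the `β`-norms. -/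
lemma exists_nnorm_le_mul_nnorm (hα : IsAdmissible A α) (hβ : IsAdmissible A β)
    (h : ∀ u, MemC00 A β u → MemC00 A α u) :
    ∃ C > 0, ∀ n x, nnorm A α n x ≤ C * nnorm A β n x := by
  obtain ⟨K, hK⟩ : ∃ K : ℕ, ∀ᶠ n in atTop, ∀ x, nnorm A α n x ≤ K * nnorm A β n x := by
    by_contra! hcon
    have hfreq : ∀ k : ℕ, ∃ᶠ n in atTop, n ≠ 0 ∧ ∃ x, k * nnorm A β n x < nnorm A α n x := by
      intro k
      refine (((hcon k).and_eventually (eventually_ne_atTop 0))).mono fun n hn => ⟨hn.2, ?_⟩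
      simpa using hn.1
    obtain ⟨φ, hφ, hφP⟩ := extraction_forall_of_frequently hfreq
    choose hφ0 x hx using hφP
    have hpos : ∀ k, 0 < nnorm A α (φ k) (x k) := fun k =>
      (mul_nonneg k.cast_nonneg (nnorm_nonneg _ _ _ _)).trans_lt (hx k)
    let u : ℕ → E := Function.extend φ (fun k => (nnorm A α (φ k) (x k))⁻¹ • x k) 0
    have huφ : ∀ k, u (φ k) = (nnorm A α (φ k) (x k))⁻¹ • x k := fun k =>
      hφ.injective.extend_apply _ _ k
    have hu : MemC00 A β u := by
      constructor
      · exact Function.extend_apply' _ _ _ fun ⟨k, hk⟩ => hφ0 k hk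
      · refine tendsto_order.2 ⟨fun l hl => .of_forall fun n => hl.trans_le (nnorm_nonneg _ _ _ _),
          fun ε hε => ?_⟩
        obtain ⟨N, hN⟩ := exists_nat_gt ε⁻¹
        filter_upwards [eventually_ge_atTop (φ N)] with n hn
        by_cases hk : ∃ k, φ k = n
        · obtain ⟨k, rfl⟩ := hk
          have hNk : (N : ℝ) ≤ k := by exact_mod_cast hφ.le_iff_le.1 hn
          have hk0 : 0 < (k : ℝ) := ((inv_pos.2 hε).trans hN).trans_le hNk
          rw [huφ, nnorm_smul, abs_of_pos (inv_pos.2 (hpos k)), inv_mul_lt_iff₀ (hpos k)]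
          have h1 : 1 < k * ε := by
            rw [← inv_lt_iff_one_lt_mul₀ hε]
            exact hN.trans_le hNk
          have h2 := mul_lt_mul_of_pos_left (hx k) hε
          nlinarith [nnorm_nonneg A β (φ k) (x k)]
        · rw [show u n = 0 from Function.extend_apply' _ _ _ hk, nnorm_zero]
          exact hε
    have h0 := (h u hu).2.comp hφ.tendsto_atTop
    have h1 : (fun n => nnorm A α n (u n)) ∘ φ = fun _ => 1 := by
      ext k
      simp only [Function.comp_apply]
      rw [huφ, nnorm_smul, abs_of_pos (inv_pos.2 (hpos k)), inv_mul_cancel₀ (hpos k).ne']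
    rw [h1] at h0
    exact one_ne_zero (tendsto_nhds_unique tendsto_const_nhds h0)
  obtain ⟨N, hN⟩ := eventually_atTop.1 hK
  obtain ⟨M, hM, hMx⟩ := hα.exists_nnorm_le
  have hsum : 0 ≤ ∑ i ∈ Finset.range N, M i := Finset.sum_nonneg fun i _ => (hM i).le
  refine ⟨K + ∑ i ∈ Finset.range N, M i + 1, by positivity, fun n x => ?_⟩
  have hβ0 := nnorm_nonneg A β n x
  rcases le_or_gt N n with hn | hn
  · refine (hN n hn x).trans ?_
    gcongr
    linarith
  · have h1 := Finset.single_le_sum (fun i _ => (hM i).le) (Finset.mem_range.2 hn)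
    calc nnorm A α n x ≤ M n * ‖x‖ := hMx n x
      _ ≤ M n * nnorm A β n x := by
          gcongr
          · exact (hM n).le
          · exact hβ.norm_le_nnorm n x
      _ ≤ _ := by
          gcongr
          have : (0 : ℝ) ≤ K := K.cast_nonneg
          linarith

lemma GInvertible.of_memC00_iff (hα : IsAdmissible A α) (hβ : IsAdmissible A β) (hβ0 : β < 0)
    (h : ∀ u, MemC00 A α u ↔ MemC00 A β u) : GInvertible A α := by
  obtain ⟨C, hC, hCx⟩ := exists_nnorm_le_mul_nnorm hα hβ fun u => (h u).2
  obtain ⟨D, hD, hDx⟩ := exists_nnorm_le_mul_nnorm hβ hα fun u => (h u).1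
  have h1 : 0 < 1 - Real.exp β := sub_pos.2 (by simpa using hβ0)
  refine ⟨fun u => hα.memC00_Gmap, fun v hv => ?_, fun u hu hG => ?_,
    C * ((1 - Real.exp β)⁻¹ * D), by positivity, fun u hu => ?_⟩
  · obtain ⟨u, rfl⟩ := exists_Gmap_eq A v
    exact ⟨u, (h u).2 (hβ.memC00_of_Gmap hβ0 ((h _).1 hv)), rfl⟩
  · refine Gmap_injective A (hG.trans ?_)
    ext n
    cases n <;> simp [Gmap_zero, Gmap_succ]
  · refine ciSup_le fun n => (hCx n _).trans ?_
    rw [mul_assoc, mul_assoc]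
    gcongr
    refine hβ.nnorm_le_of_Gmap hβ0 hu.1 (fun k => (hDx k _).trans ?_) n
    gcongr
    exact (hα.memC00_Gmap hu).nnorm_le_cnorm k

/-- Testing `G⁻¹` on finitely supported weights `b` along an orbit. -/
lemma GInvertible.exists_sum_mul_nnorm_le (hG : GInvertible A α) :
    ∃ c > 0, ∀ (n : ℕ) (x : E) (b : ℕ → ℝ) (B : ℝ), n ≠ 0 → (∀ j, 0 ≤ b j) →
      (∀ᶠ j in atTop, b j = 0) → (∀ j, b j * nnorm A α (n + j) (evol A n (n + j) x) ≤ B) →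
      ∀ j, (∑ i ∈ Finset.range (j + 1), b i) * nnorm A α (n + j) (evol A n (n + j) x) ≤ c * B := by
  obtain ⟨-, hsurj, -, c, hc, hbound⟩ := hG
  refine ⟨c, hc, fun n x b B hn hb hb0 hB j => ?_⟩
  let v : ℕ → E := fun k => if n ≤ k then b (k - n) • evol A n k x else 0
  have hvlt : ∀ k, k < n → v k = 0 := fun k hk => if_neg (by omega)
  have hvadd : ∀ k, v (n + k) = b k • evol A n (n + k) x := fun k => by simp [v]
  have hv : MemC00 A α v := by
    refine ⟨hvlt 0 (by omega), tendsto_const_nhds.congr' ?_⟩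
    obtain ⟨N, hN⟩ := eventually_atTop.1 hb0
    filter_upwards [eventually_ge_atTop (n + N)] with k hk
    obtain ⟨i, rfl⟩ := Nat.exists_eq_add_of_le (show n ≤ k by omega)
    rw [hvadd, hN i (by omega), zero_smul, nnorm_zero]
  obtain ⟨u, hu, huv⟩ := hsurj v hv
  have hrec : ∀ k, u (k + 1) = A k (u k) - v (k + 1) := fun k => by
    rw [← huv, Gmap_succ]; abel
  have hult : ∀ k, k < n → u k = 0 := by
    intro k
    induction k with
    | zero => exact fun _ => hu.1
    | succ k ih => intro hk; rw [hrec, ih (by omega), hvlt _ hk]; simp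
  have huadd : ∀ k, u (n + k) = -((∑ i ∈ Finset.range (k + 1), b i) • evol A n (n + k) x) := by
    intro k
    induction k with
    | zero =>
      obtain ⟨p, rfl⟩ := Nat.exists_eq_succ_of_ne_zero hn
      have := hvadd 0
      simp only [add_zero] at this ⊢
      rw [hrec, hult p (by omega), this]
      simp
    | succ k ih =>
      rw [← add_assoc, hrec, ih, add_assoc n k 1, hvadd, Finset.sum_range_succ _ (k + 1),
        add_smul, ← add_assoc n k 1, evol_succ A (by omega : n ≤ n + k)]
      simp only [map_neg, map_smul, mul_apply_eq_comp]
      abel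
  have hB0 : 0 ≤ B := (mul_nonneg (hb 0) (nnorm_nonneg _ _ _ _)).trans (hB 0)
  have hcv : cnorm A α v ≤ B := by
    refine ciSup_le fun k => ?_
    rcases lt_or_ge k n with hk | hk
    · rwa [hvlt k hk, nnorm_zero]
    · obtain ⟨i, rfl⟩ := Nat.exists_eq_add_of_le hk
      rw [hvadd, nnorm_smul, abs_of_nonneg (hb i)]
      exact hB i
  calc (∑ i ∈ Finset.range (j + 1), b i) * nnorm A α (n + j) (evol A n (n + j) x)
      = nnorm A α (n + j) (u (n + j)) := by
        rw [huadd, nnorm_neg, nnorm_smul, abs_of_nonneg (Finset.sum_nonneg fun i _ => hb i)]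
    _ ≤ cnorm A α u := hu.nnorm_le_cnorm _
    _ ≤ c * cnorm A α (Gmap A u) := hbound u hu
    _ ≤ c * B := by rw [huv]; gcongr

lemma GInvertible.exists_exp_decay (hG : GInvertible A α) :
    ∃ ν > 0, ∃ K > 0, ∀ (n : ℕ) (x : E) (j : ℕ), n ≠ 0 →
      Real.exp (ν * j) * nnorm A α (n + j) (evol A n (n + j) x) ≤ K * nnorm A α n x := by
  obtain ⟨c, hc, key⟩ := hG.exists_sum_mul_nnorm_le
  have hw0 : 0 < (2 * c)⁻¹ := by positivity
  obtain ⟨w, hw⟩ : ∃ w : ℝ, w = 1 + (2 * c)⁻¹ := ⟨_, rfl⟩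
  have hw1 : 1 < w := by linarith
  have hwpos : 0 < w := by linarith
  refine ⟨Real.log w, Real.log_pos hw1, 2 * c, by positivity, fun n x j hn => ?_⟩
  set a : ℕ → ℝ := fun j => nnorm A α (n + j) (evol A n (n + j) x) with ha
  have ha_nonneg : ∀ j, 0 ≤ a j := fun j => nnorm_nonneg _ _ _ _
  have ha0 : a 0 = nnorm A α n x := by simp [ha, evol_self]
  have hunif : ∀ j, a j ≤ c * a 0 := by
    intro j
    have h := key n x (fun i => if i = 0 then 1 else 0) (a 0) hn
      (fun i => by positivity)
      ((eventually_ne_atTop 0).mono fun i hi => if_neg hi)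
      (fun i => by
        rcases eq_or_ne i 0 with rfl | hi
        · simp [ha]
        · simpa [hi] using ha_nonneg 0) j
    simpa using h
  obtain ⟨k, hk, hmax⟩ := Finset.exists_max_image (Finset.range (j + 1)) (fun i => w ^ i * a i)
    ⟨0, by simp⟩
  have hkj : k ≤ j := by simpa [Nat.lt_succ_iff] using hk
  have h := key n x (fun i => if i ≤ j then w ^ i else 0) (w ^ k * a k) hn
    (fun i => by positivity)
    ((eventually_gt_atTop j).mono fun i hi => if_neg (by omega))
    (fun i => by
      by_cases hi : i ≤ j
      · simpa [hi] using hmax i (by simpa [Nat.lt_succ_iff] using hi)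
      · simpa [hi] using mul_nonneg (pow_pos hwpos k).le (ha_nonneg k)) k
  have hsum : ∑ i ∈ Finset.range (k + 1), (if i ≤ j then w ^ i else 0) =
      2 * c * (w ^ (k + 1) - 1) := by
    rw [Finset.sum_congr rfl (g := fun i => w ^ i)
      fun i hi => if_pos (by rw [Finset.mem_range] at hi; omega), geom_sum_eq hw1.ne',
      show w - 1 = (2 * c)⁻¹ by linarith, div_inv_eq_mul, mul_comm]
  rw [hsum, pow_succ] at h
  change 2 * c * (w ^ k * w - 1) * a k ≤ c * (w ^ k * a k) at h
  have hkk : w ^ k * a k ≤ 2 * c * a 0 := by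
    have h1 : 2 * (w ^ k * w - 1) * a k ≤ w ^ k * a k := by
      refine le_of_mul_le_mul_left ?_ hc
      linarith
    have h2 : w ^ k * a k ≤ w ^ k * a k * w :=
      le_mul_of_one_le_right (mul_nonneg (pow_pos hwpos k).le (ha_nonneg k)) hw1.le
    linarith [hunif k]
  rw [mul_comm (Real.log w), Real.exp_nat_mul, Real.exp_log hwpos, ← ha0]
  exact (hmax j (by simp)).trans hkk

lemma IsAdmissible.of_succ {β : ℝ} {M : ℕ → ℝ} (hM : ∀ n, 0 < M n)
    (h : ∀ m n : ℕ, n ≠ 0 → n ≤ m → ‖evol A n m‖ ≤ M n * Real.exp (β * ((m : ℝ) - n))) :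
    IsAdmissible A β := by
  have h1 := hM 1
  refine ⟨fun n => if n = 0 then 1 + M 1 * Real.exp (-β) * ‖A 0‖ else M n, fun n => ?_,
    fun m n hnm => ?_⟩
  · dsimp only
    split_ifs
    · positivity
    · exact hM n
  · rcases eq_or_ne n 0 with rfl | hn
    · rcases Nat.eq_zero_or_pos m with rfl | hm
      · have h2 : ‖(1 : E →L[ℝ] E)‖ ≤ 1 := ContinuousLinearMap.norm_id_le
        have h3 : 0 ≤ M 1 * Real.exp (-β) * ‖A 0‖ := by positivity
        simpa [evol_self] using h2.trans (le_add_of_nonneg_right h3)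
      · rw [evol_eq_mul A hm]
        simp only [if_pos]
        calc ‖evol A (0 + 1) m * A 0‖ ≤ ‖evol A (0 + 1) m‖ * ‖A 0‖ := norm_mul_le _ _
          _ ≤ M 1 * Real.exp (β * ((m : ℝ) - (1 : ℕ))) * ‖A 0‖ := by
              gcongr
              exact h m 1 one_ne_zero hm
          _ = M 1 * Real.exp (-β) * ‖A 0‖ * Real.exp (β * ((m : ℝ) - (0 : ℕ))) := by
              rw [show β * ((m : ℝ) - (1 : ℕ)) = -β + β * ((m : ℝ) - (0 : ℕ)) by push_cast; ring,
                Real.exp_add]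
              ring
          _ ≤ _ := by
              gcongr
              exact le_add_of_nonneg_left zero_le_one
    · simp only [if_neg hn]
      exact h m n hn hnm

lemma GInvertible.exists_memC00_iff (hα : IsAdmissible A α) (hG : GInvertible A α) :
    ∃ β : ℝ, β < 0 ∧ IsAdmissible A β ∧ ∀ u : ℕ → E, MemC00 A α u ↔ MemC00 A β u := by
  rcases lt_or_ge α 0 with hα0 | hα0
  · exact ⟨α, hα0, hα, fun u => Iff.rfl⟩
  obtain ⟨ν, hν, K, hK, hdecay⟩ := hG.exists_exp_decay
  have hnorm : ∀ m n : ℕ, n ≠ 0 → n ≤ m → ∀ x,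
      Real.exp (ν * ((m : ℝ) - n)) * ‖evol A n m x‖ ≤ K * nnorm A α n x := by
    intro m n hn hnm x
    obtain ⟨j, rfl⟩ := Nat.exists_eq_add_of_le hnm
    refine le_trans ?_ (hdecay n x j hn)
    rw [show (((n + j : ℕ) : ℝ) - n) = j by push_cast; ring]
    gcongr
    exact hα.norm_le_nnorm _ _
  obtain ⟨M, hM, hMx⟩ := hα.exists_nnorm_le
  have hβ : IsAdmissible A (-ν) := by
    refine .of_succ (M := fun n => K * M n) (fun n => mul_pos hK (hM n)) fun m n hn hnm => ?_
    have hMn := hM n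
    refine ContinuousLinearMap.opNorm_le_bound _ (by positivity) fun x => ?_
    have h1 := (hnorm m n hn hnm x).trans (mul_le_mul_of_nonneg_left (hMx n x) hK.le)
    rw [← le_div_iff₀' (Real.exp_pos _)] at h1
    refine h1.trans_eq ?_
    rw [neg_mul, Real.exp_neg]
    field_simp
  refine ⟨-ν, by linarith, hβ, fun u => ⟨fun hu => ?_, fun hu => ?_⟩⟩
  · refine hu.of_nnorm_le (K := K) ((eventually_ne_atTop 0).mono fun n hn x => ?_)
    refine nnorm_le fun m hm => ?_
    rw [neg_neg]
    exact hnorm m n hn hm x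
  · refine hu.of_nnorm_le (K := 1) (.of_forall fun n x => ?_)
    rw [one_mul]
    exact hβ.nnorm_le_nnorm (by linarith) n x

end

/-- `G_α` is invertible on `c00(α)` iff there is an admissible exponent
`β < 0` with `c00(α) = c00(β)` (as sets of sequences). -/
theorem stmt8 (A : ℕ → E →L[ℝ] E) (α : ℝ) (hα : IsAdmissible A α) :
    GInvertible A α ↔
      ∃ β : ℝ, β < 0 ∧ IsAdmissible A β ∧
        ∀ u : ℕ → E, MemC00 A α u ↔ MemC00 A β u := by
  constructor
  · exact fun hG => hG.exists_memC00_iff hα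
  · rintro ⟨β, hβ0, hβ, h⟩
    exact .of_memC00_iff hα hβ hβ0 h
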